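/- Let k be a field, V a finite-dimensional k-vector space, and f a nonzero homogeneous polynomial of degree d on V. Then g_sym(f) ≤ (d+1)·c(f); moreover, if d is odd and char(k) ≠ 2, then g_sym(f) ≤ d·c(f). -/

import Mathlib

open MvPolynomial

/-- Krull dimension of the closed subscheme of affine space cut out by an ideal of the
polynomial ring. -/
noncomputable def affineDim {σ : Type} [Fintype σ] (k : Type) [Field k]
    (I : Ideal (MvPolynomial σ k)) : WithBot ℕ∞ :=
  ringKrullDim (MvPolynomial σ k ⧸ I)

/-- Codimension (inside the affine space of dimension `card σ`) of the closed subscheme of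
affine space cut out by an ideal; the empty scheme has codimension `⊤`. -/
noncomputable def affineCodim {σ : Type} [Fintype σ] (k : Type) [Field k]
    (I : Ideal (MvPolynomial σ k)) : ℕ∞ :=
  WithBot.recBotCoe ⊤ (fun dm => (Fintype.card σ : ℕ∞) - dm) (affineDim k I)

/-- The ideal of `Z^sym_f ⊆ V × V`: in the coordinates `(v, x)` (with `v` the `Sum.inl`
variables and `x` the `Sum.inr` variables) it is generated, for `i : Fin n`, by
`∑ j, v j * (∂_i ∂_j f)(x)`, i.e. its zero locus is `{(v, x) | v ∈ ker H_f(x)}` where `H_f`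
is the Hessian form of `f`. -/
noncomputable def zSymIdeal {k : Type} [Field k] {n : ℕ} (f : MvPolynomial (Fin n) k) :
    Ideal (MvPolynomial (Fin n ⊕ Fin n) k) :=
  Ideal.span (Set.range fun i : Fin n =>
    ∑ j : Fin n, X (Sum.inl j) * rename Sum.inr (pderiv i (pderiv j f)))

/-- The ideal of the singular locus of the hypersurface `f = 0`: it is generated by `f`
together with all first partial derivatives of `f`. -/
noncomputable def singIdeal {k : Type} [Field k] {n : ℕ} (f : MvPolynomial (Fin n) k) :
    Ideal (MvPolynomial (Fin n) k) :=
  Ideal.span ({f} ∪ Set.range fun i => pderiv i f)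

theorem ringKrullDim_eq_of_injective_of_isIntegral {A B : Type*} [CommRing A] [CommRing B]
    (g : A →+* B) (hg : Function.Injective g) (hi : g.IsIntegral) :
    ringKrullDim B = ringKrullDim A := by
  algebraize [g]
  have hinj : Function.Injective (algebraMap A B) := hg
  have : FaithfulSMul A B := (faithfulSMul_iff_algebraMap_injective A B).mpr hinj
  apply le_antisymm
  · refine Order.krullDim_le_of_strictMono (PrimeSpectrum.comap (algebraMap A B)) ?_
    intro p q hpq
    exact Ideal.IsIntegral.comap_lt_comap (R := A) hpq
  · refine iSup_le fun l => ?_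
    obtain ⟨Q, -, hQ, hQl⟩ := Ideal.exists_ideal_over_prime_of_isIntegral (S := B)
      l.head.asIdeal ⊥ (by
        rw [← RingHom.ker_eq_comap_bot, (RingHom.injective_iff_ker_eq_bot _).mp hinj]; exact bot_le)
    have : Q.LiesOver l.head.asIdeal := ⟨hQl.symm⟩
    obtain ⟨L, hL, -⟩ := Ideal.exists_ltSeries_of_hasGoingUp l Q
    rw [← hL]
    exact le_iSup (fun l : LTSeries (PrimeSpectrum B) => (l.length : WithBot ℕ∞)) L

theorem Finsupp.exists_eq_single_add {σ : Type*} {α : σ →₀ ℕ} (h : α ≠ 0) :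
    ∃ i β, α = Finsupp.single i 1 + β := by
  obtain ⟨i, hi⟩ := Finsupp.ne_iff.mp h
  refine ⟨i, α - Finsupp.single i 1, (add_tsub_cancel_of_le ?_).symm⟩
  rw [Finsupp.single_le_iff]
  exact Nat.one_le_iff_ne_zero.mpr hi

theorem exists_card_le_and_monomial_mem_span {k A σ : Type*} [Field k] [CommRing A] [Algebra k A]
    [Finite σ] (x : σ → A) {e : ℕ} (g : MvPolynomial (Fin e) k →ₐ[k] A) (hg : g.Finite) :
    ∃ r E : ℕ, ∀ L : ℕ, ∃ w : Finset A, w.card ≤ r * (E * (L + 1) + 1) ^ e ∧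
      ∀ α : σ →₀ ℕ, α.degree ≤ L → aeval x (monomial α (1 : k)) ∈ Submodule.span k (w : Set A) := by
  classical
  cases nonempty_fintype σ
  algebraize [g.toRingHom]
  have hfin : Module.Finite (MvPolynomial (Fin e) k) A := hg
  obtain ⟨r, m, hm⟩ := Module.Finite.exists_fin (R := MvPolynomial (Fin e) k) (M := A)
  have hspan : ∀ a : A, ∃ q : Fin r → MvPolynomial (Fin e) k, ∑ l, g (q l) * m l = a := by
    intro a
    have ha : a ∈ Submodule.span (MvPolynomial (Fin e) k) (Set.range m) := hm ▸ Submodule.mem_top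
    obtain ⟨q, hq⟩ := (Submodule.mem_span_range_iff_exists_fun _).mp ha
    exact ⟨q, by rw [← hq]; exact Finset.sum_congr rfl fun l _ => (Algebra.smul_def _ _).symm⟩
  choose q hq using hspan
  let E : ℕ := Finset.univ.sup (fun l => (q 1 l).totalDegree) +
    Finset.univ.sup (fun t : σ × Fin r × Fin r => (q (x t.1 * m t.2.1) t.2.2).totalDegree)
  have hE1 : ∀ l, (q 1 l).totalDegree ≤ E := fun l =>
    (Finset.le_sup (f := fun l => (q 1 l).totalDegree) (Finset.mem_univ l)).trans
      (Nat.le_add_right _ _)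
  have hE2 : ∀ i j l, (q (x i * m j) l).totalDegree ≤ E := fun i j l =>
    (Finset.le_sup (f := fun t : σ × Fin r × Fin r => (q (x t.1 * m t.2.1) t.2.2).totalDegree)
      (Finset.mem_univ (i, j, l))).trans (Nat.le_add_left _ _)
  have key : ∀ (N : ℕ) (α : σ →₀ ℕ), α.degree = N →
      ∃ p : Fin r → MvPolynomial (Fin e) k, (∀ l, (p l).totalDegree ≤ E * (N + 1)) ∧
        aeval x (monomial α (1 : k)) = ∑ l, g (p l) * m l := by
    intro N
    induction N with
    | zero =>
      intro α hα
      obtain rfl : α = 0 := (Finsupp.degree_eq_zero_iff α).mp hα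
      exact ⟨q 1, by simpa using hE1, by rw [hq]; simp⟩
    | succ N ih =>
      intro α hα
      obtain ⟨i, β, rfl⟩ := Finsupp.exists_eq_single_add (α := α) (by rintro rfl; simp at hα)
      obtain ⟨p, hp, hpβ⟩ := ih β (by simp at hα; omega)
      refine ⟨fun l => ∑ j, p j * q (x i * m j) l, fun l => ?_, ?_⟩
      · refine (totalDegree_finsetSum_le fun j _ => (totalDegree_mul _ _).trans
          (add_le_add (hp j) (hE2 i j l))).trans (le_of_eq (by ring))
      · have : (monomial (Finsupp.single i 1 + β) (1 : k)) = X i * monomial β 1 := by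
          rw [X, monomial_mul, one_mul]
        rw [this, map_mul, hpβ, aeval_X, Finset.mul_sum]
        simp only [map_sum, map_mul, Finset.sum_mul]
        rw [Finset.sum_comm]
        refine Finset.sum_congr rfl fun j _ => ?_
        rw [mul_left_comm, ← hq (x i * m j), Finset.mul_sum]
        refine Finset.sum_congr rfl fun l _ => by rw [hq]; ring
  refine ⟨r, E, fun L => ?_⟩
  let v : Fin r × (Fin e → Fin (E * (L + 1) + 1)) → A := fun t =>
    g (monomial (Finsupp.equivFunOnFinite.symm fun i => (t.2 i : ℕ)) 1) * m t.1
  refine ⟨Finset.univ.image v, Finset.card_image_le.trans (by simp), fun α hα => ?_⟩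
  obtain ⟨p, hp, h⟩ := key _ α rfl
  rw [h]
  refine Submodule.sum_mem _ fun l _ => ?_
  rw [(p l).as_sum, map_sum, Finset.sum_mul]
  refine Submodule.sum_mem _ fun γ hγ => ?_
  have hγi : ∀ i, γ i < E * (L + 1) + 1 := by
    intro i
    have h1 := le_totalDegree hγ
    have h2 : γ i ≤ γ.degree := Finsupp.le_degree i γ
    have h3 : E * (α.degree + 1) ≤ E * (L + 1) := Nat.mul_le_mul_left _ (by omega)
    have h4 := hp l
    change γ.degree ≤ _ at h1
    omega
  have : monomial γ (coeff γ (p l)) = coeff γ (p l) • monomial γ (1 : k) := by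
    rw [smul_monomial, smul_eq_mul, mul_one]
  rw [this, map_smul, smul_mul_assoc]
  refine Submodule.smul_mem _ _ (Submodule.subset_span ?_)
  simp only [Finset.coe_image, Finset.coe_univ, Set.image_univ]
  refine ⟨(l, fun i => ⟨γ i, hγi i⟩), ?_⟩
  have hγe : (Finsupp.equivFunOnFinite.symm fun i => γ i) = γ := by ext; simp
  simp only [v, hγe]

theorem exists_ringHom_comp_eq_of_isIntegral {R B Ω : Type*} [CommRing R] [IsDomain R] [CommRing B]
    [Field Ω] [IsAlgClosed Ω] (g : R →+* B) (hg : Function.Injective g) (hi : g.IsIntegral)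
    (φ : R →+* Ω) (hφ : Function.Injective φ) : ∃ ψ : B →+* Ω, ψ.comp g = φ := by
  algebraize [g, φ]
  have hinj : Function.Injective (algebraMap R B) := hg
  obtain ⟨Q, -, hQ, hQl⟩ := Ideal.exists_ideal_over_prime_of_isIntegral (S := B) (⊥ : Ideal R) ⊥ (by
    rw [← RingHom.ker_eq_comap_bot, (RingHom.injective_iff_ker_eq_bot _).mp hinj])
  have hinjQ : Function.Injective (algebraMap R (B ⧸ Q)) := by
    rw [RingHom.injective_iff_ker_eq_bot, ← hQl]
    ext r
    rw [RingHom.mem_ker, Ideal.mem_comap, ← Ideal.Quotient.eq_zero_iff_mem]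
    rfl
  have : FaithfulSMul R (B ⧸ Q) := (faithfulSMul_iff_algebraMap_injective _ _).mpr hinjQ
  have : FaithfulSMul R Ω := (faithfulSMul_iff_algebraMap_injective _ _).mpr hφ
  let ψ : (B ⧸ Q) →ₐ[R] Ω := IsAlgClosed.lift
  refine ⟨ψ.toRingHom.comp (Ideal.Quotient.mk Q), ?_⟩
  ext r
  exact ψ.commutes r

theorem exists_generic_points {k K : Type} [Field k] [Field K] [Algebra k K] {n : ℕ} (d : ℕ)
    (I : Ideal (MvPolynomial (Fin n) k)) (hI : I ≠ ⊤) :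
    ∃ s : ℕ, ringKrullDim (MvPolynomial (Fin n) k ⧸ I) = s ∧
      ∃ (y : Fin s → MvPolynomial (Fin n) k) (Ω : Type) (_ : Field Ω) (_ : Algebra K Ω)
        (_ : Algebra k Ω) (_ : IsScalarTower k K Ω) (a : Fin d → Fin n → Ω),
        (∀ i, ∀ g ∈ I, aeval (a i) g = 0) ∧
        AlgebraicIndependent K (fun p : Fin d × Fin s => aeval (a p.1) (y p.2)) := by
  obtain ⟨s, -, g, hginj, hgint⟩ := exists_integral_inj_algHom_of_quotient I hI
  refine ⟨s, ?_, ?_⟩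
  · rw [ringKrullDim_eq_of_injective_of_isIntegral g.toRingHom hginj hgint]
    simp
  choose y hy using fun j : Fin s => Ideal.Quotient.mk_surjective (I := I) (g (X j))
  let F := FractionRing (MvPolynomial (Fin d × Fin s) K)
  let Ω := AlgebraicClosure F
  let Y : Fin d × Fin s → Ω := fun p =>
    algebraMap F Ω (algebraMap (MvPolynomial (Fin d × Fin s) K) F (X p))
  have hY : AlgebraicIndependent K Y :=
    ((MvPolynomial.algebraicIndependent_X (Fin d × Fin s) K).map'
      (f := IsScalarTower.toAlgHom K _ F) (IsFractionRing.injective _ F)).map'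
      (f := IsScalarTower.toAlgHom K F Ω) (algebraMap F Ω).injective
  have : IsScalarTower k K Ω := inferInstance
  have hYk : AlgebraicIndependent k Y := hY.restrictScalars (algebraMap k K).injective
  have hψ : ∀ i : Fin d, ∃ ψ : (MvPolynomial (Fin n) k ⧸ I) →+* Ω,
      ψ.comp g.toRingHom = (aeval fun j => Y (i, j) : MvPolynomial (Fin s) k →ₐ[k] Ω).toRingHom :=
    fun i => exists_ringHom_comp_eq_of_isIntegral _ hginj hgint _
      (hYk.comp (fun j => (i, j)) (Prod.mk_right_injective i))
  choose ψ hψ using hψ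
  have hval : ∀ (i : Fin d) (p : MvPolynomial (Fin n) k),
      aeval (fun l => ψ i (Ideal.Quotient.mk I (X l))) p = ψ i (Ideal.Quotient.mk I p) := by
    intro i p
    induction p using MvPolynomial.induction_on with
    | C c =>
      have := RingHom.congr_fun (hψ i) (C c)
      simp only [AlgHom.toRingHom_eq_coe, RingHom.coe_comp, RingHom.coe_coe, Function.comp_apply,
        algHom_C] at this
      rw [algHom_C, ← this]
      rfl
    | add p q hp hq => simp only [map_add, hp, hq]
    | mul_X p l hp => simp only [map_mul, hp, aeval_X]
  refine ⟨y, Ω, inferInstance, inferInstance, inferInstance, this,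
    fun i l => ψ i (Ideal.Quotient.mk I (X l)), ?_, ?_⟩
  · intro i p hp
    rw [hval, Ideal.Quotient.eq_zero_iff_mem.mpr hp, map_zero]
  · have hfun : (fun p : Fin d × Fin s =>
        aeval (R := k) (fun l => ψ p.1 (Ideal.Quotient.mk I (X l))) (y p.2)) = Y := by
      refine _root_.funext fun p => ?_
      rw [hval, hy]
      have := RingHom.congr_fun (hψ p.1) (X p.2)
      simpa using this
    rw [hfun]
    exact hY

theorem exists_monomial_basis_of_isHomogeneous {k σ : Type*} [Field k]
    (I : Ideal (MvPolynomial σ k))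
    (hI : ∀ p ∈ I, ∀ r, homogeneousComponent r p ∈ I) :
    ∃ M : Set (σ →₀ ℕ),
      LinearIndepOn k (fun α => Ideal.Quotient.mk I (monomial α (1 : k))) M ∧
      ∀ α : σ →₀ ℕ, ∃ w ∈ Submodule.span k
        ((fun μ => monomial μ (1 : k)) '' {μ | μ ∈ M ∧ μ.degree = α.degree}),
        monomial α 1 - w ∈ I := by
  obtain ⟨κ, a, ha, hspan, hli⟩ := exists_linearIndependent' k
    (fun α : σ →₀ ℕ => Ideal.Quotient.mk I (monomial α (1 : k)))
  refine ⟨Set.range a, (linearIndepOn_range_iff ha _).mpr hli, fun α => ?_⟩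
  have hα : Ideal.Quotient.mk I (monomial α (1 : k)) ∈ Submodule.span k
      (Set.range ((fun α : σ →₀ ℕ => Ideal.Quotient.mk I (monomial α (1 : k))) ∘ a)) := by
    rw [hspan]; exact Submodule.subset_span ⟨α, rfl⟩
  have himg : Set.range ((fun α : σ →₀ ℕ => Ideal.Quotient.mk I (monomial α (1 : k))) ∘ a) =
      (Ideal.Quotient.mkₐ k I).toLinearMap ''
        ((fun μ => monomial μ (1 : k)) '' Set.range a) := by
    rw [← Set.range_comp, ← Set.range_comp]; rfl
  rw [himg, ← Submodule.map_span] at hα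
  obtain ⟨w, hw, hwα⟩ := hα
  refine ⟨homogeneousComponent α.degree w, ?_, ?_⟩
  · have := Submodule.mem_map_of_mem (f := homogeneousComponent α.degree) hw
    rw [Submodule.map_span] at this
    refine Submodule.span_le.mpr ?_ this
    rintro _ ⟨_, ⟨μ, hμ, rfl⟩, rfl⟩
    simp only
    rw [homogeneousComponent_of_mem (isHomogeneous_monomial (1 : k) rfl)]
    split_ifs with h
    · exact Submodule.subset_span ⟨μ, ⟨hμ, h.symm⟩, rfl⟩
    · exact Submodule.zero_mem _
  · have h1 : monomial α 1 - w ∈ I := Ideal.Quotient.eq.mp hwα.symm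
    have h2 := hI _ h1 α.degree
    rwa [map_sub, homogeneousComponent_eq_self (isHomogeneous_monomial (1 : k) rfl)] at h2

theorem monomial_mem_span_sup_of_le_map {K σ τ : Type*} [Field K]
    (I : Ideal (MvPolynomial σ K)) (J : Ideal (MvPolynomial (σ ⊕ τ) K))
    (hJ : ∀ p ∈ J, ∀ r, homogeneousComponent r p ∈ J)
    (hIJ : I ≤ J.map (aeval (Sum.elim X 0) : MvPolynomial (σ ⊕ τ) K →ₐ[K] MvPolynomial σ K))
    (M : Set (σ →₀ ℕ))
    (hM : ∀ α : σ →₀ ℕ, ∃ w ∈ Submodule.span K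
        ((fun μ => monomial μ (1 : K)) '' {μ | μ ∈ M ∧ μ.degree = α.degree}),
        monomial α 1 - w ∈ I) (γ : σ ⊕ τ →₀ ℕ) :
    monomial γ (1 : K) ∈ Submodule.span K
      {p | ∃ μ ∈ M, ∃ β : τ →₀ ℕ, μ.degree + β.degree = γ.degree ∧
        p = rename Sum.inl (monomial μ (1 : K)) * rename Sum.inr (monomial β (1 : K))} ⊔
      J.restrictScalars K := by
  set π : MvPolynomial (σ ⊕ τ) K →ₐ[K] MvPolynomial σ K := aeval (Sum.elim X 0) with hπ
  let W : ℕ → Submodule K (MvPolynomial (σ ⊕ τ) K) := fun r => Submodule.span K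
      {p | ∃ μ ∈ M, ∃ β : τ →₀ ℕ, μ.degree + β.degree = r ∧
        p = rename Sum.inl (monomial μ (1 : K)) * rename Sum.inr (monomial β (1 : K))} ⊔
      J.restrictScalars K
  have hπι : ∀ p, π (rename Sum.inl p) = p := fun p => by
    rw [hπ, aeval_rename]
    exact aeval_X_left_apply p
  have hπhom : ∀ r p, homogeneousComponent r (π p) = π (homogeneousComponent r p) := by
    intro r p
    induction p using MvPolynomial.induction_on' with
    | add p q hp hq => simp only [map_add, hp, hq]
    | monomial γ c =>
      have h1 : (π (monomial γ c)).IsHomogeneous (1 * γ.degree) :=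
        (isHomogeneous_monomial c rfl).aeval _ (fun i => by
          cases i with
          | inl i => exact isHomogeneous_X _ _
          | inr i => exact isHomogeneous_zero _ _ _)
      rw [one_mul] at h1
      rw [homogeneousComponent_of_mem h1, homogeneousComponent_of_mem (isHomogeneous_monomial c rfl)]
      split_ifs <;> simp
  have hmul : ∀ (j : τ) (r : ℕ), ∀ p ∈ W r, X (Sum.inr j) * p ∈ W (r + 1) := by
    intro j r p hp
    obtain ⟨u, hu, q, hq, rfl⟩ := Submodule.mem_sup.mp hp
    rw [mul_add]
    refine Submodule.add_mem_sup ?_ (J.mul_mem_left _ hq)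
    have := Submodule.mem_map_of_mem (f := LinearMap.mulLeft K (X (Sum.inr j))) hu
    rw [Submodule.map_span] at this
    refine Submodule.span_mono ?_ this
    rintro _ ⟨_, ⟨μ, hμ, β, hβ, rfl⟩, rfl⟩
    refine ⟨μ, hμ, Finsupp.single j 1 + β, by simp; omega, ?_⟩
    have : (monomial (Finsupp.single j 1 + β) (1 : K)) = X j * monomial β 1 := by
      rw [X, monomial_mul, one_mul]
    rw [LinearMap.mulLeft_apply, this, map_mul (rename _), rename_X]
    ring
  have hsplit : ∀ γ : σ ⊕ τ →₀ ℕ, (∃ j δ, γ = Finsupp.single (Sum.inr j) 1 + δ) ∨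
      ∃ α : σ →₀ ℕ, γ = α.mapDomain Sum.inl := by
    intro γ
    by_cases h : ∃ j, γ (Sum.inr j) ≠ 0
    · obtain ⟨j, hj⟩ := h
      refine Or.inl ⟨j, γ - Finsupp.single (Sum.inr j) 1, (add_tsub_cancel_of_le ?_).symm⟩
      rw [Finsupp.single_le_iff]
      exact Nat.one_le_iff_ne_zero.mpr hj
    · push Not at h
      refine Or.inr ⟨γ.comapDomain Sum.inl Sum.inl_injective.injOn, ?_⟩
      rw [Finsupp.mapDomain_comapDomain _ Sum.inl_injective]
      intro i hi
      cases i with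
      | inl i => exact ⟨i, rfl⟩
      | inr i => simp [h i] at hi
  have hX : ∀ (j : τ) (δ : σ ⊕ τ →₀ ℕ),
      monomial (Finsupp.single (Sum.inr j) 1 + δ) (1 : K) = X (Sum.inr j) * monomial δ 1 := by
    intro j δ
    rw [X, monomial_mul, one_mul]
  suffices h : ∀ r, ∀ γ : σ ⊕ τ →₀ ℕ, γ.degree = r → monomial γ (1 : K) ∈ W r from h _ γ rfl
  clear γ
  intro r
  induction r using Nat.strong_induction_on with
  | _ r ih =>
  have hin : ∀ j δ, (Finsupp.single (Sum.inr j) 1 + δ : σ ⊕ τ →₀ ℕ).degree = r →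
      monomial (Finsupp.single (Sum.inr j) 1 + δ) (1 : K) ∈ W r := by
    intro j δ h
    have h' : δ.degree + 1 = r := by simp at h; omega
    rw [hX, ← h']
    exact hmul j _ _ (ih _ (by omega) δ rfl)
  have hdiff : ∀ p : MvPolynomial (σ ⊕ τ) K, p.IsHomogeneous r →
      p - rename Sum.inl (π p) ∈ W r := by
    intro p hp
    rw [p.as_sum, map_sum, map_sum, ← Finset.sum_sub_distrib]
    refine Submodule.sum_mem _ fun γ hγ => ?_
    have hγr : γ.degree = r := by
      by_contra hne
      exact (mem_support_iff.mp hγ) (hp.coeff_eq_zero hne)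
    have hc : monomial γ (coeff γ p) = coeff γ p • monomial γ (1 : K) := by
      rw [smul_monomial, smul_eq_mul, mul_one]
    rw [hc, map_smul, map_smul, ← smul_sub]
    refine Submodule.smul_mem _ _ ?_
    rcases hsplit γ with ⟨j, δ, rfl⟩ | ⟨α, rfl⟩
    · have : π (monomial (Finsupp.single (Sum.inr j) 1 + δ) (1 : K)) = 0 := by
        rw [hX, map_mul, hπ, aeval_X]; simp
      rw [this, map_zero, sub_zero]
      exact hin j δ hγr
    · rw [← rename_monomial, hπι, sub_self]
      exact Submodule.zero_mem _
  intro γ hγ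
  rcases hsplit γ with ⟨j, δ, rfl⟩ | ⟨α, rfl⟩
  · exact hin j δ hγ
  · have hα : α.degree = r := by rw [← hγ, Finsupp.degree_mapDomain]
    obtain ⟨w, hw, hwI⟩ := hM α
    have hπs : Function.Surjective π := fun p => ⟨_, hπι p⟩
    obtain ⟨q, hq, hqw⟩ := (Ideal.mem_map_iff_of_surjective _ hπs).mp (hIJ hwI)
    have hwr : w.IsHomogeneous r := by
      rw [← mem_homogeneousSubmodule]
      refine Submodule.span_le.mpr ?_ hw
      rintro _ ⟨μ, ⟨-, hμ⟩, rfl⟩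
      exact isHomogeneous_monomial 1 (hμ.trans hα)
    have hqr : π (homogeneousComponent r q) = monomial α 1 - w := by
      rw [← hπhom, ← homogeneousComponent_eq_self ((isHomogeneous_monomial (1 : K) hα).sub hwr)]
      exact congrArg _ hqw
    have h1 := hdiff _ (homogeneousComponent_isHomogeneous r q)
    have h2 : homogeneousComponent r q ∈ W r := Submodule.mem_sup_right (hJ q hq r)
    have h3 := (W r).sub_mem h2 h1
    rw [sub_sub_cancel, hqr, map_sub, rename_monomial] at h3
    have h4 : rename Sum.inl w ∈ W r := by
      have := Submodule.mem_map_of_mem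
        (f := (rename Sum.inl : _ →ₐ[K] MvPolynomial (σ ⊕ τ) K).toLinearMap) hw
      rw [Submodule.map_span] at this
      refine Submodule.mem_sup_left (Submodule.span_mono ?_ this)
      rintro _ ⟨_, ⟨μ, ⟨hμ, hμα⟩, rfl⟩, rfl⟩
      exact ⟨μ, hμ, 0, by simp [hμα, hα], by simp⟩
    have := (W r).add_mem h3 h4
    rwa [sub_add_cancel] at this

theorem exists_sum_smul_aeval_eq_sum_mul_aeval_pderiv {K : Type*} [Field K] {d : ℕ} (hd : 2 ≤ d)
    (t : Fin d → K) (ht : Function.Injective t) :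
    ∃ c : Fin d → K, ∀ {k A σ : Type*} [Field k] [CommRing A] [Fintype σ] [Algebra k A]
      [Algebra K A] (g : MvPolynomial σ k) (_ : g.totalDegree < d) (x v : σ → A),
      ∑ i, c i • aeval (fun l => x l + algebraMap K A (t i) * v l) g =
        ∑ j, v j * aeval x (pderiv j g) := by
  classical
  let V := Matrix.vandermonde t
  have hV : IsUnit V.det := (Matrix.det_vandermonde_ne_zero_iff.mpr ht).isUnit
  refine ⟨Matrix.vecMul (Pi.single ⟨1, hd⟩ 1) V⁻¹, ?_⟩
  set c := Matrix.vecMul (Pi.single ⟨1, hd⟩ 1) V⁻¹ with hc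
  have hcV : Matrix.vecMul c V = Pi.single ⟨1, hd⟩ 1 := by
    rw [hc, Matrix.vecMul_vecMul, Matrix.nonsing_inv_mul _ hV, Matrix.vecMul_one]
  have hcV' : ∀ j : Fin d, ∑ i, c i * t i ^ (j : ℕ) = if j = ⟨1, hd⟩ then 1 else 0 := by
    intro j
    have := congrFun hcV j
    rw [Pi.single_apply] at this
    rw [← this]
    rfl
  intro k A σ _ _ _ _ _ g hg x v
  let L : σ → Polynomial A := fun l => Polynomial.C (x l) + Polynomial.X * Polynomial.C (v l)
  let G : Polynomial A := aeval L g
  have hcoeff : ∀ p : MvPolynomial σ k, (aeval L p).coeff 0 = aeval x p ∧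
      (aeval L p).coeff 1 = ∑ j, v j * aeval x (pderiv j p) := by
    intro p
    induction p using MvPolynomial.induction_on with
    | C c =>
      simp only [algHom_C, Polynomial.algebraMap_apply, pderiv_C, map_zero, mul_zero,
        Finset.sum_const_zero, Polynomial.coeff_C_zero, true_and]
      exact Polynomial.coeff_C_of_ne_zero one_ne_zero
    | add p q hp hq =>
      simp only [map_add, Polynomial.coeff_add, hp, hq, mul_add, Finset.sum_add_distrib, and_self]
    | mul_X p l hp =>
      have h0 : (L l).coeff 0 = x l := by simp [L]
      have h1 : (L l).coeff 1 = v l := by simp [L]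
      constructor
      · rw [map_mul, aeval_X, Polynomial.mul_coeff_zero, hp.1, h0, map_mul, aeval_X]
      · rw [map_mul, aeval_X, Polynomial.mul_coeff_one, hp.1, hp.2, h0, h1]
        simp only [pderiv_mul, pderiv_X, map_add, map_mul, aeval_X, mul_add, Finset.sum_add_distrib,
          Pi.single_apply, apply_ite (aeval x), map_zero, mul_ite, mul_one, mul_zero,
          Finset.sum_ite_eq, Finset.mem_univ, if_true, Finset.sum_mul]
        rw [add_comm, mul_comm (v l)]
        simp only [mul_assoc]
  have hdeg : G.natDegree < d := by
    have h1 : G = aeval L (MvPolynomial.map (algebraMap k A) g) := (aeval_map_algebraMap A L g).symm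
    have hm : (MvPolynomial.map (algebraMap k A) g).totalDegree ≤ g.totalDegree :=
      Finset.sup_mono (support_map_subset _ _)
    have h2 := aeval_natDegree_le (n := 1) (MvPolynomial.map (algebraMap k A) g) hm L (fun l => by
        simp only [L]; compute_degree)
    rw [h1]
    omega
  have heval : ∀ i, aeval (fun l => x l + algebraMap K A (t i) * v l) g =
      ∑ j : Fin d, algebraMap K A (t i ^ (j : ℕ)) * G.coeff j := by
    intro i
    have h1 : aeval (fun l => x l + algebraMap K A (t i) * v l) g =
        G.eval (algebraMap K A (t i)) := by
      have : aeval (fun l => x l + algebraMap K A (t i) * v l) =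
          ((Polynomial.aeval (algebraMap K A (t i))).restrictScalars k :
            Polynomial A →ₐ[k] A).comp (aeval L) := by
        ext l
        simp [L]
        exact mul_comm _ _
      rw [this]
      simp [G]
    rw [h1, Polynomial.eval_eq_sum_range' hdeg, Finset.sum_range]
    refine Finset.sum_congr rfl fun j _ => ?_
    rw [map_pow, mul_comm]
  simp only [heval, Finset.smul_sum]
  rw [Finset.sum_comm, ← (hcoeff g).2]
  have : ∀ j : Fin d, ∑ i, c i • (algebraMap K A (t i ^ (j : ℕ)) * G.coeff j) =
      if j = ⟨1, hd⟩ then G.coeff j else 0 := by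
    intro j
    simp only [Algebra.smul_def, ← mul_assoc, ← map_mul, ← Finset.sum_mul, ← map_sum]
    rw [hcV']
    split_ifs <;> simp
  simp only [this, Finset.sum_ite_eq', Finset.mem_univ, if_true]
  rfl

theorem AlgebraicIndependent.card_le_of_growth {K υ Ω ι : Type*} [Field K] [CommRing Ω]
    [Algebra K Ω] [Fintype ι] (ev : MvPolynomial υ K →ₐ[K] Ω) (y : ι → MvPolynomial υ K)
    (hy : AlgebraicIndependent K (fun i => ev (y i))) (C b : ℕ)
    (h : ∀ L : ℕ, ∃ W : Finset Ω, W.card ≤ C * (L + 1) ^ b ∧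
      ∀ γ : υ →₀ ℕ, γ.degree ≤ L → ev (monomial γ 1) ∈ Submodule.span K (W : Set Ω)) :
    Fintype.card ι ≤ b := by
  classical
  have : Nontrivial Ω := hy.algebraMap_injective.nontrivial
  let D := Finset.univ.sup fun i => (y i).totalDegree
  have hD : ∀ i, (y i).totalDegree ≤ D := fun i =>
    Finset.le_sup (f := fun i => (y i).totalDegree) (Finset.mem_univ i)
  let c := Fintype.card ι
  have hbound : ∀ N : ℕ, (N + 1) ^ c ≤ C * (D * c + 1) ^ b * (N + 1) ^ b := by
    intro N
    obtain ⟨W, hWc, hW⟩ := h (N * (D * c))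
    let m : (ι → Fin (N + 1)) → (ι →₀ ℕ) := fun β =>
      Finsupp.equivFunOnFinite.symm fun i => (β i : ℕ)
    have hm : Function.Injective m := by
      intro β β' hββ
      ext i
      exact DFunLike.congr_fun hββ i
    have hli : LinearIndependent K fun β => aeval (fun i => ev (y i)) (monomial (m β) (1 : K)) := by
      have h1 : LinearIndependent K fun γ : ι →₀ ℕ => monomial γ (1 : K) :=
        (basisMonomials ι K).linearIndependent
      exact (h1.comp m hm).map' (aeval fun i => ev (y i)).toLinearMap
        (LinearMap.ker_eq_bot.mpr hy)
    have hmem : Set.range (fun β => aeval (fun i => ev (y i)) (monomial (m β) (1 : K))) ≤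
        (Submodule.span K (W : Set Ω) : Set Ω) := by
      rintro _ ⟨β, rfl⟩
      have h1 : aeval (fun i => ev (y i)) (monomial (m β) (1 : K)) =
          ev (∏ i, y i ^ (β i : ℕ)) := by
        rw [aeval_monomial, map_one, one_mul, map_prod, Finsupp.prod_fintype _ _ (by simp)]
        simp [m]
      have hdeg : (∏ i, y i ^ (β i : ℕ)).totalDegree ≤ N * (D * c) := by
        refine (totalDegree_finsetProd _ _).trans ((Finset.sum_le_card_nsmul _ _ (N * D)
          fun i _ => (totalDegree_pow _ _).trans (Nat.mul_le_mul ?_ (hD i))).trans (le_of_eq ?_))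
        · exact Nat.lt_succ_iff.mp (β i).2
        · simp only [Finset.card_univ, smul_eq_mul, c]; ring
      simp only [h1]
      rw [(∏ i, y i ^ (β i : ℕ)).as_sum, map_sum]
      refine Submodule.sum_mem _ fun γ hγ => ?_
      have : monomial γ (coeff γ (∏ i, y i ^ (β i : ℕ))) =
          coeff γ (∏ i, y i ^ (β i : ℕ)) • monomial γ (1 : K) := by
        rw [smul_monomial, smul_eq_mul, mul_one]
      rw [this, map_smul]
      exact Submodule.smul_mem _ _ (hW γ ((le_totalDegree hγ).trans hdeg))
    have hcard := linearIndependent_le_span' _ hli (W : Set Ω) hmem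
    simp only [Cardinal.mk_fintype, Finset.coe_sort_coe, Fintype.card_coe, Nat.cast_le,
      Fintype.card_fun, Fintype.card_fin] at hcard
    calc (N + 1) ^ c ≤ C * (N * (D * c) + 1) ^ b := hcard.trans hWc
      _ ≤ C * ((D * c + 1) * (N + 1)) ^ b := by gcongr; nlinarith
      _ = _ := by rw [mul_pow, mul_assoc]
  by_contra! hlt
  set C' := C * (D * c + 1) ^ b
  have h1 := hbound C'
  have h2 : (C' + 1) ^ (b + 1) ≤ (C' + 1) ^ c := Nat.pow_le_pow_right (Nat.succ_pos _) hlt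
  have h3 : (C' + 1) * (C' + 1) ^ b ≤ C' * (C' + 1) ^ b := by
    rw [← pow_succ']; exact h2.trans h1
  have := Nat.le_of_mul_le_mul_right h3 (by positivity)
  omega

theorem homogeneousComponent_mem_span {R σ : Type*} [CommRing R] {s : Set (MvPolynomial σ R)}
    (hs : ∀ p ∈ s, ∃ r, p.IsHomogeneous r) {p : MvPolynomial σ R} (hp : p ∈ Ideal.span s) (r : ℕ) :
    homogeneousComponent r p ∈ Ideal.span s := by
  let _ := MvPolynomial.gradedAlgebra (σ := σ) (R := R)
  have h : (Ideal.span s).IsHomogeneous (homogeneousSubmodule σ R) :=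
    Ideal.homogeneous_span _ _ fun p hp => hs p hp
  exact homogeneousComponent_mem_of_mem h hp r

theorem pderiv_pderiv_comm {R σ : Type*} [CommRing R] (i j : σ) (p : MvPolynomial σ R) :
    pderiv i (pderiv j p) = pderiv j (pderiv i p) := by
  classical
  have h : ⁅(pderiv i : Derivation R (MvPolynomial σ R) (MvPolynomial σ R)),
      (pderiv j : Derivation R (MvPolynomial σ R) (MvPolynomial σ R))⁆ = 0 := by
    refine derivation_ext fun l => ?_
    rw [Derivation.commutator_apply, pderiv_X, pderiv_X]
    simp only [Pi.single_apply]
    split_ifs <;> simp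
  have := DFunLike.congr_fun h p
  rwa [Derivation.commutator_apply, Derivation.zero_apply, sub_eq_zero] at this

theorem homogeneousComponent_mem_zSymIdeal {k : Type} [Field k] {n d : ℕ}
    {f : MvPolynomial (Fin n) k} (hf : f.IsHomogeneous d) {p : MvPolynomial (Fin n ⊕ Fin n) k}
    (hp : p ∈ zSymIdeal f) (r : ℕ) : homogeneousComponent r p ∈ zSymIdeal f := by
  refine homogeneousComponent_mem_span ?_ hp r
  rintro _ ⟨i, rfl⟩
  refine ⟨1 + (d - 1 - 1), IsHomogeneous.sum _ _ _ fun j _ => ?_⟩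
  exact (isHomogeneous_X _ _).mul (hf.pderiv.pderiv.rename_isHomogeneous)

theorem zSymIdeal_ne_top {k : Type} [Field k] {n : ℕ} (f : MvPolynomial (Fin n) k) :
    zSymIdeal f ≠ ⊤ := by
  have h : zSymIdeal f ≤ RingHom.ker (aeval (R := k) (fun _ => (0 : k))) := by
    refine Ideal.span_le.mpr ?_
    rintro _ ⟨i, rfl⟩
    simp [RingHom.mem_ker]
  intro htop
  rw [htop, top_le_iff] at h
  exact RingHom.ker_ne_top _ h

/-- The affine-linear forms `x + tᵢ v + ℓᵢ`, with `ℓ₀ = ℓ₁ = 0` and all other `ℓᵢ` generic. -/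
noncomputable def pencilForm {K : Type*} [Field K] {n m : ℕ} (t : Fin (m + 2) → K)
    (i : Fin (m + 2)) (l : Fin n) : MvPolynomial ((Fin n ⊕ Fin n) ⊕ (Fin m × Fin n)) K :=
  X (Sum.inl (Sum.inr l)) + C (t i) * X (Sum.inl (Sum.inl l)) +
    (Fin.cons 0 (Fin.cons 0 fun i l => X (Sum.inr (i, l))) :
      Fin (m + 2) → Fin n → MvPolynomial ((Fin n ⊕ Fin n) ⊕ (Fin m × Fin n)) K) i l

theorem pencilForm_isHomogeneous {K : Type*} [Field K] {n m : ℕ} (t : Fin (m + 2) → K)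
    (i : Fin (m + 2)) (l : Fin n) : (pencilForm t i l).IsHomogeneous 1 := by
  refine ((isHomogeneous_X _ _).add (by
    simpa using (isHomogeneous_C _ (t i)).mul (isHomogeneous_X _ _))).add ?_
  refine Fin.cases ?_ (fun i => Fin.cases ?_ (fun i => ?_) i) i
  · exact isHomogeneous_zero _ _ _
  · exact isHomogeneous_zero _ _ _
  · exact isHomogeneous_X _ _

/-- The ideal of the locus where every `pencilForm t i` is a critical point of `f`. -/
noncomputable def pencilIdeal {k K : Type*} [Field k] [Field K] [Algebra k K] {n m : ℕ}
    (t : Fin (m + 2) → K) (f : MvPolynomial (Fin n) k) :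
    Ideal (MvPolynomial ((Fin n ⊕ Fin n) ⊕ (Fin m × Fin n)) K) :=
  Ideal.span (Set.range fun p : Fin (m + 2) × Fin n => aeval (pencilForm t p.1) (pderiv p.2 f))

theorem homogeneousComponent_mem_pencilIdeal {k K : Type*} [Field k] [Field K] [Algebra k K]
    {n m d : ℕ} (t : Fin (m + 2) → K) {f : MvPolynomial (Fin n) k} (hf : f.IsHomogeneous d)
    {p : MvPolynomial ((Fin n ⊕ Fin n) ⊕ (Fin m × Fin n)) K} (hp : p ∈ pencilIdeal t f) (r : ℕ) :
    homogeneousComponent r p ∈ pencilIdeal t f := by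
  refine homogeneousComponent_mem_span ?_ hp r
  rintro _ ⟨q, rfl⟩
  exact ⟨_, hf.pderiv.aeval _ (pencilForm_isHomogeneous t q.1)⟩

theorem map_zSymIdeal_le_map_pencilIdeal {k K : Type} [Field k] [Field K] [Algebra k K] {n m : ℕ}
    (t : Fin (m + 2) → K) (ht : Function.Injective t) {f : MvPolynomial (Fin n) k}
    (hf : f.IsHomogeneous (m + 2)) :
    (zSymIdeal f).map (MvPolynomial.map (algebraMap k K)) ≤
      (pencilIdeal t f).map (aeval (Sum.elim X 0) :
        MvPolynomial ((Fin n ⊕ Fin n) ⊕ (Fin m × Fin n)) K →ₐ[K] _) := by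
  obtain ⟨c, hc⟩ := exists_sum_smul_aeval_eq_sum_mul_aeval_pderiv (by omega) t ht
  rw [zSymIdeal, Ideal.map_span, Ideal.span_le]
  rintro _ ⟨_, ⟨i, rfl⟩, rfl⟩
  have hdeg : (pderiv i f).totalDegree < m + 2 :=
    hf.pderiv.totalDegree_le.trans_lt (by omega)
  have h := hc (A := MvPolynomial (Fin n ⊕ Fin n) K) (pderiv i f) hdeg
    (fun l => X (Sum.inr l)) (fun l => X (Sum.inl l))
  have h' : MvPolynomial.map (algebraMap k K)
      (∑ j : Fin n, X (Sum.inl j) * rename Sum.inr (pderiv i (pderiv j f))) =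
      ∑ j, X (Sum.inl j) * aeval (fun l => X (Sum.inr l)) (pderiv j (pderiv i f)) := by
    rw [map_sum]
    refine Finset.sum_congr rfl fun j _ => ?_
    rw [map_mul, map_X, pderiv_pderiv_comm i j, map_rename, rename_eq_aeval,
      aeval_map_algebraMap]
    rfl
  simp only [SetLike.mem_coe]
  rw [h', ← h]
  refine Ideal.sum_mem _ fun a _ => ?_
  rw [Algebra.smul_def]
  refine Ideal.mul_mem_left _ _ ?_
  have hmem : aeval (pencilForm t a) (pderiv i f) ∈ pencilIdeal t f :=
    Ideal.subset_span ⟨(a, i), rfl⟩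
  have := Ideal.mem_map_of_mem (aeval (Sum.elim X 0) :
    MvPolynomial ((Fin n ⊕ Fin n) ⊕ (Fin m × Fin n)) K →ₐ[K] MvPolynomial (Fin n ⊕ Fin n) K) hmem
  convert this using 1
  change _ = ((aeval (Sum.elim X 0) : MvPolynomial ((Fin n ⊕ Fin n) ⊕ (Fin m × Fin n)) K →ₐ[K]
    MvPolynomial (Fin n ⊕ Fin n) K).restrictScalars k) (aeval (pencilForm t a) (pderiv i f))
  rw [← AlgHom.comp_apply, comp_aeval]
  congr 2
  refine _root_.funext fun l => ?_
  have h0 : aeval (Sum.elim X 0 : _ → MvPolynomial (Fin n ⊕ Fin n) K)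
      ((Fin.cons 0 (Fin.cons 0 fun i l => X (Sum.inr (i, l))) :
      Fin (m + 2) → Fin n → MvPolynomial ((Fin n ⊕ Fin n) ⊕ (Fin m × Fin n)) K) a l) = 0 := by
    refine Fin.cases ?_ (fun i => Fin.cases ?_ (fun i => ?_) i) a <;> simp
  simp [pencilForm, algebraMap_eq]
  exact h0

theorem exists_card_le_of_linearIndepOn_monomial {k σ : Type*} [Field k] [Finite σ]
    (I : Ideal (MvPolynomial σ k)) (hI : I ≠ ⊤) :
    ∃ e : ℕ, ringKrullDim (MvPolynomial σ k ⧸ I) = e ∧ ∃ C : ℕ, ∀ M : Set (σ →₀ ℕ),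
      LinearIndepOn k (fun α => Ideal.Quotient.mk I (monomial α (1 : k))) M →
      ∀ L : ℕ, ∃ S : Finset (σ →₀ ℕ), (∀ μ, μ ∈ S ↔ μ ∈ M ∧ μ.degree ≤ L) ∧
        S.card ≤ C * (L + 1) ^ e := by
  have := Ideal.Quotient.nontrivial_iff.mpr hI
  obtain ⟨e, g, hinj, hfin⟩ := exists_finite_inj_algHom_of_fg k (MvPolynomial σ k ⧸ I)
  refine ⟨e, ?_, ?_⟩
  · rw [ringKrullDim_eq_of_injective_of_isIntegral g.toRingHom hinj hfin.to_isIntegral]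
    simp
  obtain ⟨r, E, h⟩ := exists_card_le_and_monomial_mem_span
    (fun i => Ideal.Quotient.mk I (X i)) g hfin
  refine ⟨r * (E + 1) ^ e, fun M hM L => ?_⟩
  obtain ⟨w, hwc, hw⟩ := h L
  let T : Set (σ →₀ ℕ) := {μ | μ ∈ M ∧ μ.degree ≤ L}
  have hT : LinearIndepOn k (fun α => Ideal.Quotient.mk I (monomial α (1 : k))) T :=
    hM.mono fun μ hμ => hμ.1
  have haeval : ∀ p, aeval (fun i => Ideal.Quotient.mk I (X i)) p = Ideal.Quotient.mk I p := by
    intro p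
    exact DFunLike.congr_fun (aeval_unique (Ideal.Quotient.mkₐ k I)).symm p
  have hle := linearIndependent_le_span' _ hT (w : Set (MvPolynomial σ k ⧸ I)) (by
    rintro _ ⟨μ, rfl⟩
    have := hw μ.1 μ.2.2
    rwa [haeval] at this)
  have hTfin : T.Finite := by
    rw [← Set.finite_coe_iff]
    exact Cardinal.lt_aleph0_iff_finite.mp (hle.trans_lt (Cardinal.natCast_lt_aleph0))
  refine ⟨hTfin.toFinset, fun μ => by simp [T], ?_⟩
  have hcard : hTfin.toFinset.card ≤ w.card := by
    have := hTfin.fintype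
    rw [Cardinal.mk_fintype, Nat.cast_le] at hle
    rw [hTfin.card_toFinset]
    simpa only [Finset.coe_sort_coe, Fintype.card_coe] using hle
  calc hTfin.toFinset.card ≤ r * (E * (L + 1) + 1) ^ e := hcard.trans hwc
    _ ≤ r * ((E + 1) * (L + 1)) ^ e := by gcongr; nlinarith
    _ = _ := by rw [mul_pow, mul_assoc]

theorem exists_krullDim_zSymIdeal_singIdeal {k : Type} [Field k] {n m : ℕ}
    {f : MvPolynomial (Fin n) k} (hf : f.IsHomogeneous (m + 2)) (hsing : singIdeal f ≠ ⊤) :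
    ∃ e s : ℕ, ringKrullDim (MvPolynomial (Fin n ⊕ Fin n) k ⧸ zSymIdeal f) = e ∧
      ringKrullDim (MvPolynomial (Fin n) k ⧸ singIdeal f) = s ∧ (m + 2) * s ≤ e + m * n := by
  classical
  let K := AlgebraicClosure k
  have : Infinite K := IsAlgClosed.instInfinite
  let t : Fin (m + 2) → K := fun i => Infinite.natEmbedding K i
  have ht : Function.Injective t := (Infinite.natEmbedding K).injective.comp Fin.val_injective
  obtain ⟨e, he, C, hC⟩ := exists_card_le_of_linearIndepOn_monomial _ (zSymIdeal_ne_top f)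
  obtain ⟨M, hMli, hM⟩ := exists_monomial_basis_of_isHomogeneous (zSymIdeal f)
    fun p hp r => homogeneousComponent_mem_zSymIdeal hf hp r
  obtain ⟨s, hs, y, Ω, _, _, _, _, a, ha, hy⟩ :=
    exists_generic_points (K := K) (m + 2) (singIdeal f) hsing
  refine ⟨e, s, he, hs, ?_⟩
  have hMK : ∀ α : Fin n ⊕ Fin n →₀ ℕ, ∃ w ∈ Submodule.span K
      ((fun μ => monomial μ (1 : K)) '' {μ | μ ∈ M ∧ μ.degree = α.degree}),
      monomial α 1 - w ∈ (zSymIdeal f).map (MvPolynomial.map (algebraMap k K)) := by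
    intro α
    obtain ⟨w, hw, hwI⟩ := hM α
    refine ⟨MvPolynomial.map (algebraMap k K) w, ?_, ?_⟩
    · refine Submodule.span_induction (p := fun w _ => MvPolynomial.map (algebraMap k K) w ∈
        Submodule.span K ((fun μ => monomial μ (1 : K)) '' {μ | μ ∈ M ∧ μ.degree = α.degree}))
        ?_ ?_ ?_ ?_ hw
      · rintro _ ⟨μ, hμ, rfl⟩
        exact Submodule.subset_span ⟨μ, hμ, by simp⟩
      · simp
      · intro p q _ _ hp hq
        rw [map_add]
        exact add_mem hp hq
      · intro c p _ hp
        rw [smul_eq_C_mul, map_mul, map_C, ← smul_eq_C_mul]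
        exact Submodule.smul_mem _ _ hp
    · have := Ideal.mem_map_of_mem (MvPolynomial.map (algebraMap k K)) hwI
      simpa using this
  have hspan := monomial_mem_span_sup_of_le_map _ (pencilIdeal t f)
    (fun p hp r => homogeneousComponent_mem_pencilIdeal t hf hp r)
    (map_zSymIdeal_le_map_pencilIdeal t ht hf) M hMK
  -- the `Ω`-point of the pencil at which `pencilForm t i` takes the value `a i`
  let τ : Fin (m + 2) → Ω := fun i => algebraMap K Ω (t i)
  let v : Fin n → Ω := fun l => (a 1 l - a 0 l) / (τ 1 - τ 0)
  let x : Fin n → Ω := fun l => a 0 l - τ 0 * v l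
  let ev : MvPolynomial ((Fin n ⊕ Fin n) ⊕ (Fin m × Fin n)) K →ₐ[K] Ω :=
    aeval (Sum.elim (Sum.elim v x)
      fun q => a q.1.succ.succ q.2 - x q.2 - τ q.1.succ.succ * v q.2)
  have hτ : τ 1 - τ 0 ≠ 0 := by
    rw [sub_ne_zero]
    intro h
    have := ht ((algebraMap K Ω).injective h)
    simp at this
  have hev : ∀ i l, ev (pencilForm t i l) = a i l := by
    intro i l
    simp only [pencilForm, map_add, map_mul, ev, aeval_X, Sum.elim_inl, Sum.elim_inr, algHom_C]
    change x l + τ i * v l + _ = _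
    refine Fin.cases ?_ (fun i => Fin.cases ?_ (fun i => ?_) i) i
    · simp [x]
    · have hx : x l + τ 1 * v l = a 1 l := by
        simp only [x, v]
        field_simp
        ring
      simp only [Fin.cons_succ, Fin.cons_zero, Pi.zero_apply, map_zero, add_zero]
      exact hx
    · simp
  have hevp : ∀ i (p : MvPolynomial (Fin n) k), ev (aeval (pencilForm t i) p) = aeval (a i) p := by
    intro i p
    change (ev.restrictScalars k) (aeval (pencilForm t i) p) = _
    rw [← AlgHom.comp_apply, comp_aeval]
    congr 2
    exact _root_.funext fun l => hev i l
  have hevJ : ∀ p ∈ pencilIdeal t f, ev p = 0 := by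
    intro p hp
    have hle : pencilIdeal t f ≤ RingHom.ker ev := by
      refine Ideal.span_le.mpr ?_
      rintro _ ⟨q, rfl⟩
      refine (hevp q.1 _).trans (ha _ _ (Ideal.subset_span (Or.inr ⟨q.2, rfl⟩)))
    exact hle hp
  have hcard := AlgebraicIndependent.card_le_of_growth ev
    (fun p : Fin (m + 2) × Fin s => aeval (pencilForm t p.1) (y p.2))
    (by simpa only [hevp] using hy) C (e + m * n) (fun L => by
      obtain ⟨S, hS, hSc⟩ := hC M hMli L
      let B : (Fin m × Fin n → Fin (L + 1)) → (Fin m × Fin n →₀ ℕ) := fun β =>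
        Finsupp.equivFunOnFinite.symm fun i => (β i : ℕ)
      refine ⟨(S ×ˢ (Finset.univ : Finset (Fin m × Fin n → Fin (L + 1)))).image fun q =>
        ev (rename Sum.inl (monomial q.1 (1 : K)) * rename Sum.inr (monomial (B q.2) (1 : K))),
        ?_, fun γ hγ => ?_⟩
      · refine Finset.card_image_le.trans ?_
        rw [Finset.card_product, Finset.card_univ, Fintype.card_fun, Fintype.card_fin,
          Fintype.card_prod, Fintype.card_fin, Fintype.card_fin, pow_add, ← mul_assoc]
        gcongr
      · obtain ⟨u, hu, q, hq, huq⟩ := Submodule.mem_sup.mp (hspan γ)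
        rw [← huq, map_add, hevJ q hq, add_zero]
        have := Submodule.mem_map_of_mem (f := ev.toLinearMap) hu
        rw [Submodule.map_span] at this
        refine Submodule.span_mono ?_ this
        rintro _ ⟨_, ⟨μ, hμ, β, hβ, rfl⟩, rfl⟩
        have hβL : ∀ i, β i < L + 1 := fun i => by
          have := Finsupp.le_degree i β
          omega
        rw [Finset.mem_coe, Finset.mem_image]
        refine ⟨(μ, fun i => ⟨β i, hβL i⟩), ?_, ?_⟩
        · exact Finset.mk_mem_product ((hS μ).mpr ⟨hμ, by omega⟩) (Finset.mem_univ _)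
        · have : B (fun i => ⟨β i, hβL i⟩) = β := by ext i; rfl
          simp only [this]
          rfl)
  simpa using hcard

theorem zSymIdeal_eq_bot {k : Type} [Field k] {n d : ℕ} {f : MvPolynomial (Fin n) k}
    (hf : f.IsHomogeneous d) (hd : d ≤ 1) : zSymIdeal f = ⊥ := by
  rw [zSymIdeal, Ideal.span_eq_bot]
  rintro _ ⟨i, rfl⟩
  refine Finset.sum_eq_zero fun j _ => ?_
  have h : (pderiv j f).IsHomogeneous 0 := by
    have := hf.pderiv (i := j)
    rwa [Nat.sub_eq_zero_of_le hd] at this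
  rw [← totalDegree_zero_iff_isHomogeneous, totalDegree_eq_zero_iff_eq_C] at h
  rw [h, pderiv_C, map_zero, mul_zero]

theorem affineCodim_eq_sub {σ : Type} [Fintype σ] {k : Type} [Field k]
    {I : Ideal (MvPolynomial σ k)} {e : ℕ} (h : ringKrullDim (MvPolynomial σ k ⧸ I) = e) :
    affineCodim k I = ((Fintype.card σ - e : ℕ) : ℕ∞) := by
  rw [affineCodim, affineDim, h, ENat.natCast_sub]
  rfl

theorem affineCodim_zSymIdeal_le {k : Type} [Field k] {n d : ℕ} {f : MvPolynomial (Fin n) k}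
    (hf : f.IsHomogeneous d) :
    affineCodim k (zSymIdeal f) ≤ (d : ℕ∞) * affineCodim k (singIdeal f) := by
  by_cases hd : d ≤ 1
  · have : ringKrullDim (MvPolynomial (Fin n ⊕ Fin n) k ⧸ zSymIdeal f) =
        (Fintype.card (Fin n ⊕ Fin n) : ℕ) := by
      rw [zSymIdeal_eq_bot hf hd,
        ringKrullDim_eq_of_ringEquiv (RingEquiv.quotientBot (MvPolynomial (Fin n ⊕ Fin n) k)),
        MvPolynomial.ringKrullDim_of_isNoetherianRing, ringKrullDim_eq_zero_of_field, zero_add]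
      simp
    rw [affineCodim_eq_sub this]
    simp
  · obtain ⟨m, rfl⟩ : ∃ m, d = m + 2 := ⟨d - 2, by omega⟩
    by_cases hsing : singIdeal f = ⊤
    · have : affineCodim k (singIdeal f) = ⊤ := by
        have : Subsingleton (MvPolynomial (Fin n) k ⧸ singIdeal f) :=
          Ideal.Quotient.subsingleton_iff.mpr hsing
        rw [affineCodim, affineDim, ringKrullDim_eq_bot_of_subsingleton]
        rfl
      rw [this, ENat.mul_top (by simp)]
      exact le_top
    · obtain ⟨e, s, he, hs, hle⟩ := exists_krullDim_zSymIdeal_singIdeal hf hsing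
      rw [affineCodim_eq_sub he, affineCodim_eq_sub hs]
      norm_cast
      simp only [Fintype.card_sum, Fintype.card_fin]
      rw [Nat.mul_sub, Nat.sub_le_iff_le_add]
      have : (m + 2) * n = m * n + 2 * n := by ring
      omega

/-- Proposition 3.2(ii). For a nonzero homogeneous polynomial `f` of
degree `d` on `V`, one has `g_sym(f) ≤ (d+1) · c(f)`, and `g_sym(f) ≤ d · c(f)` when `d` is
odd and `char k ≠ 2`.  Here `g_sym(f)` is the codimension of `Z^sym_f` in `V × V` and `c(f)`
the codimension in `V` of the singular locus of the hypersurface `f = 0`. -/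
theorem gsym_le_mul_c {k : Type} [Field k] {n d : ℕ}
    (f : MvPolynomial (Fin n) k) (hf : f ≠ 0) (hhom : f.IsHomogeneous d) :
    affineCodim k (zSymIdeal f) ≤ ((d + 1 : ℕ) : ℕ∞) * affineCodim k (singIdeal f) ∧
      (Odd d → (2 : k) ≠ 0 →
        affineCodim k (zSymIdeal f) ≤ ((d : ℕ) : ℕ∞) * affineCodim k (singIdeal f)) := by
  have h := affineCodim_zSymIdeal_le hhom
  refine ⟨h.trans ?_, fun _ _ => h⟩
  gcongr
  exact Nat.le_succ d
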